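/- arXiv:1504.08097 — 5 statements merged into one kernel-verified Lean document; each statement's English description precedes it below -/
import Mathlib

section
/- If C is a self-orthogonal linear code of length n over R (that is, C ⊆ C^⊥ with respect to the Euclidean inner product), then its Gray image Ψ(C) is a self-orthogonal linear code of length 3n over F_q, i.e. Ψ(C) ⊆ Ψ(C)^⊥ with respect to the standard dot product on F_q^{3n}. -/
open Polynomial

/-- The ring `R = F_q[v]/(v³ - v)`, where `v` is the image of `X`. -/
abbrev Rv (F : Type) [Field F] : Type := AdjoinRoot (X ^ 3 - X : F[X])

lemma monicV (F : Type) [Field F] : (X ^ 3 - X : F[X]).Monic :=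
  Polynomial.monic_X_pow_sub (by simp)

/-- The `i`-th coefficient of the canonical representation `a₀ + a₁ v + a₂ v²`
of an element of `R`. -/
noncomputable def coefR (F : Type) [Field F] (i : ℕ) (x : Rv F) : F :=
  (AdjoinRoot.modByMonicHom (monicV F) x).coeff i

/-- The Gray map `Ψ : Rⁿ → F_q^{3n}`, sending each coordinate
`a₀ + a₁ v + a₂ v²` to the triple `(a₀, a₀ + a₂, a₁)`. -/
noncomputable def gray (F : Type) [Field F] {n : ℕ} (x : Fin n → Rv F) :
    Fin n × Fin 3 → F :=
  fun p => ![coefR F 0 (x p.1), coefR F 0 (x p.1) + coefR F 2 (x p.1), coefR F 1 (x p.1)] p.2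

/-- The dual of a code with respect to the Euclidean inner product `x·y = Σᵢ xᵢ yᵢ`. -/
def dualSet {A : Type} [CommRing A] {ι : Type} [Fintype ι] (C : Set (ι → A)) :
    Set (ι → A) :=
  {x | ∀ c ∈ C, ∑ i, x i * c i = 0}

/-- Hamming weight: the number of nonzero coordinates. -/
noncomputable def hWt {A : Type} [Zero A] {ι : Type} [Fintype ι] (x : ι → A) : ℕ :=
  Nat.card {i // x i ≠ 0}

/-- Lee weight: the Hamming weight of the Gray image. -/
noncomputable def leeWt (F : Type) [Field F] {n : ℕ} (x : Fin n → Rv F) : ℕ :=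
  hWt (gray F x)

/-- The cyclic (right) shift `(c₀, …, c_{n-1}) ↦ (c_{n-1}, c₀, …, c_{n-2})`. -/
def rshift {A : Type} {n : ℕ} (x : Fin n → A) : Fin n → A :=
  fun i => x ((finRotate n).symm i)

/-- A code is cyclic if it is closed under the cyclic shift. -/
def IsCyclicCode {A : Type} {n : ℕ} (C : Set (Fin n → A)) : Prop :=
  ∀ x ∈ C, rshift x ∈ C

lemma coefR_mk_quadratic {F : Type} [Field F] (a b c : F) :
    let x : Rv F := AdjoinRoot.mk _ (C a + C b * X + C c * X ^ 2)
    coefR F 0 x = a ∧ coefR F 1 x = b ∧ coefR F 2 x = c := by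
  have hdeg : (C a + C b * X + C c * X ^ 2 : F[X]).degree < (X ^ 3 - X : F[X]).degree := by
    have h : (X ^ 3 - X : F[X]).degree = 3 := by compute_degree!
    rw [h]
    refine lt_of_le_of_lt (b := 2) ?_ (by norm_num)
    compute_degree
  simp only [coefR, AdjoinRoot.modByMonicHom_mk, (modByMonic_eq_self_iff (monicV F)).2 hdeg]
  simp [coeff_X, coeff_C, coeff_X_pow]

lemma eq_mk_quadratic_coefR {F : Type} [Field F] (x : Rv F) :
    x = AdjoinRoot.mk _ (C (coefR F 0 x) + C (coefR F 1 x) * X + C (coefR F 2 x) * X ^ 2) := by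
  obtain ⟨p, rfl⟩ := AdjoinRoot.mk_surjective x
  have hne : (X ^ 3 - X : F[X]).natDegree = 3 := by compute_degree!
  have hdeg : (p %ₘ (X ^ 3 - X)).natDegree < 3 :=
    (natDegree_modByMonic_lt p (monicV F) fun h => by simp [h] at hne).trans_eq hne
  have hsum := (p %ₘ (X ^ 3 - X)).as_sum_range_C_mul_X_pow' hdeg
  simp only [Finset.sum_range_succ, Finset.sum_range_zero, pow_zero, pow_one, mul_one,
    zero_add] at hsum
  simp only [coefR, AdjoinRoot.modByMonicHom_mk]
  rw [← hsum, AdjoinRoot.mk_eq_mk]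
  exact ⟨p /ₘ (X ^ 3 - X), by linear_combination -modByMonic_add_div p (X ^ 3 - X)⟩

lemma mk_quadratic_mul {F : Type} [Field F] (a₀ a₁ a₂ b₀ b₁ b₂ : F) :
    (AdjoinRoot.mk _ (C a₀ + C a₁ * X + C a₂ * X ^ 2) *
      AdjoinRoot.mk _ (C b₀ + C b₁ * X + C b₂ * X ^ 2) : Rv F) =
    AdjoinRoot.mk _ (C (a₀ * b₀) + C (a₀ * b₁ + a₁ * b₀ + a₁ * b₂ + a₂ * b₁) * X +
      C (a₀ * b₂ + a₁ * b₁ + a₂ * b₀ + a₂ * b₂) * X ^ 2) := by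
  rw [← map_mul, AdjoinRoot.mk_eq_mk]
  refine ⟨C (a₁ * b₂ + a₂ * b₁) + C (a₂ * b₂) * X, ?_⟩
  simp only [map_add, map_mul]
  ring

/-- The dot product of Gray images is an `F`-linear functional of the product in `R`. -/
lemma gray_pairing_eq {F : Type} [Field F] (x y : Rv F) :
    coefR F 0 x * coefR F 0 y +
      (coefR F 0 x + coefR F 2 x) * (coefR F 0 y + coefR F 2 y) + coefR F 1 x * coefR F 1 y =
    2 * coefR F 0 (x * y) + coefR F 2 (x * y) := by
  have hxy : x * y = _ :=
    (congrArg₂ (· * ·) (eq_mk_quadratic_coefR x) (eq_mk_quadratic_coefR y)).trans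
      (mk_quadratic_mul _ _ _ _ _ _)
  obtain ⟨h₀, -, h₂⟩ := coefR_mk_quadratic (F := F) _ _ _
  rw [hxy, h₀, h₂]
  ring

lemma coefR_sum {F : Type} [Field F] {ι : Type} (s : Finset ι) (i : ℕ) (f : ι → Rv F) :
    coefR F i (∑ j ∈ s, f j) = ∑ j ∈ s, coefR F i (f j) := by
  simp [coefR]

lemma sum_gray_mul_gray {F : Type} [Field F] {n : ℕ} (x y : Fin n → Rv F) :
    ∑ p, gray F x p * gray F y p =
      2 * coefR F 0 (∑ i, x i * y i) + coefR F 2 (∑ i, x i * y i) := by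
  rw [coefR_sum, coefR_sum, Finset.mul_sum, ← Finset.sum_add_distrib, Fintype.sum_prod_type]
  refine Finset.sum_congr rfl fun i _ => ?_
  rw [← gray_pairing_eq]
  simp [gray, Fin.sum_univ_three]

/-- if a linear code `C ⊆ Rⁿ` is self-orthogonal, then so is its
Gray image `Ψ(C) ⊆ F_q^{3n}`. -/
theorem gray_image_self_orthogonal (F : Type) [Field F] [Finite F] (n : ℕ)
    (C : Submodule (Rv F) (Fin n → Rv F))
    (h : (C : Set (Fin n → Rv F)) ⊆ dualSet (C : Set (Fin n → Rv F))) :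
    gray F '' (C : Set (Fin n → Rv F)) ⊆ dualSet (gray F '' (C : Set (Fin n → Rv F))) := by
  rintro _ ⟨x, hx, rfl⟩ _ ⟨y, hy, rfl⟩
  rw [sum_gray_mul_gray, h hx y hy]
  simp [coefR]
end

section
/- For every linear code C of length n over R, the cardinalities of C and of its dual satisfy |C| · |C^⊥| = q^{3n} = |R|^n. -/
open Polynomial

/-- The `F`-linear functional `a₀ + a₁ v + a₂ v² ↦ a₂` on `R`. -/
noncomputable def topCoeff (F : Type) [Field F] : Rv F →ₗ[F] F :=
  Polynomial.lcoeff F 2 ∘ₗ AdjoinRoot.modByMonicHom (monicV F)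

lemma degree_X_pow_three_sub_X (F : Type) [Field F] : (X ^ 3 - X : F[X]).degree = 3 := by
  compute_degree!

lemma natDegree_X_pow_three_sub_X (F : Type) [Field F] : (X ^ 3 - X : F[X]).natDegree = 3 := by
  compute_degree!

lemma topCoeff_mk (F : Type) [Field F] (a b c : F) :
    topCoeff F (AdjoinRoot.mk _ (C a + C b * X + C c * X ^ 2)) = c := by
  have hdeg : (C a + C b * X + C c * X ^ 2 : F[X]).degree < (X ^ 3 - X : F[X]).degree := by
    rw [degree_X_pow_three_sub_X]
    refine lt_of_le_of_lt (b := 2) ?_ (by norm_num)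
    compute_degree
  simp only [topCoeff, LinearMap.comp_apply, AdjoinRoot.modByMonicHom_mk,
    (modByMonic_eq_self_iff (monicV F)).2 hdeg, lcoeff_apply]
  simp

lemma exists_eq_mk (F : Type) [Field F] (x : Rv F) :
    ∃ a b c : F, x = AdjoinRoot.mk _ (C a + C b * X + C c * X ^ 2) := by
  obtain ⟨p, rfl⟩ := AdjoinRoot.mk_surjective x
  have hdeg : (p %ₘ (X ^ 3 - X)).natDegree < 3 := by
    have h := natDegree_modByMonic_lt p (monicV F) fun h => by
      simpa [natDegree_X_pow_three_sub_X] using congrArg natDegree h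
    rwa [natDegree_X_pow_three_sub_X] at h
  have hp : AdjoinRoot.mk (X ^ 3 - X : F[X]) p = AdjoinRoot.mk _ (p %ₘ (X ^ 3 - X)) :=
    (AdjoinRoot.mk_leftInverse (monicV F) (AdjoinRoot.mk _ p)).symm
  refine ⟨(p %ₘ (X ^ 3 - X)).coeff 0, (p %ₘ (X ^ 3 - X)).coeff 1, (p %ₘ (X ^ 3 - X)).coeff 2,
    hp.trans (congrArg _ ?_)⟩
  conv_lhs => rw [(p %ₘ (X ^ 3 - X)).as_sum_range_C_mul_X_pow' hdeg]
  simp only [Finset.sum_range_succ, Finset.sum_range_zero, zero_add, pow_zero, pow_one, mul_one]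

lemma eq_zero_of_topCoeff_mul_eq_zero (F : Type) [Field F] (x : Rv F)
    (h : ∀ y, topCoeff F (x * y) = 0) : x = 0 := by
  obtain ⟨a, b, c, rfl⟩ := exists_eq_mk F x
  have hc : c = 0 := by simpa only [mul_one, topCoeff_mk] using h 1
  subst hc
  have hb : b = 0 := by
    refine (topCoeff_mk F 0 a b).symm.trans (.trans ?_ (h (AdjoinRoot.mk _ X)))
    rw [← map_mul]
    congr 2
    simp only [C_0]
    ring
  subst hb
  have ha : a = 0 := by
    refine (topCoeff_mk F 0 0 a).symm.trans (.trans ?_ (h (AdjoinRoot.mk _ (X ^ 2))))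
    rw [← map_mul]
    congr 2
    simp only [C_0]
    ring
  simp [ha]

/-- The `F`-bilinear form on `Rⁿ` sending `(x, y)` to the `v²`-coefficient of `x·y`. -/
noncomputable def topCoeffForm (F : Type) [Field F] (n : ℕ) :
    LinearMap.BilinForm F (Fin n → Rv F) :=
  LinearMap.mk₂ F (fun x y => topCoeff F (∑ i, x i * y i))
    (fun x y z => by simp only [Pi.add_apply, add_mul, Finset.sum_add_distrib, map_add])
    (fun a x y => by simp only [Pi.smul_apply, smul_mul_assoc, ← Finset.smul_sum, map_smul])
    (fun x y z => by simp only [Pi.add_apply, mul_add, Finset.sum_add_distrib, map_add])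
    (fun a x y => by simp only [Pi.smul_apply, mul_smul_comm, ← Finset.smul_sum, map_smul])

lemma topCoeffForm_apply (F : Type) [Field F] {n : ℕ} (x y : Fin n → Rv F) :
    topCoeffForm F n x y = topCoeff F (∑ i, x i * y i) :=
  rfl

lemma topCoeffForm_isSymm (F : Type) [Field F] (n : ℕ) : (topCoeffForm F n).IsSymm :=
  ⟨fun x y => by simp only [topCoeffForm_apply, mul_comm]⟩

lemma topCoeffForm_nondegenerate (F : Type) [Field F] (n : ℕ) :
    (topCoeffForm F n).Nondegenerate := by
  refine (topCoeffForm_isSymm F n).isRefl.nondegenerate_iff_separatingLeft.2 fun x hx => ?_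
  refine funext fun i => eq_zero_of_topCoeff_mul_eq_zero F (x i) fun y => ?_
  simpa [topCoeffForm_apply, Pi.single_apply] using hx (Pi.single i y)

lemma dualSet_eq_orthogonal (F : Type) [Field F] {n : ℕ}
    (C : Submodule (Rv F) (Fin n → Rv F)) :
    dualSet (C : Set (Fin n → Rv F)) =
      ((topCoeffForm F n).orthogonal (C.restrictScalars F) : Set (Fin n → Rv F)) := by
  ext x
  simp only [dualSet, Set.mem_ofPred_eq, SetLike.mem_coe, LinearMap.BilinForm.mem_orthogonal_iff,
    Submodule.restrictScalars_mem, topCoeffForm_apply]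
  constructor
  · intro h c hc
    simp only [mul_comm (c _), h c hc, map_zero]
  · refine fun h c hc => eq_zero_of_topCoeff_mul_eq_zero F _ fun y => ?_
    rw [← h (y • c) (C.smul_mem y hc), Finset.sum_mul]
    congr 1
    refine Finset.sum_congr rfl fun i _ => ?_
    rw [Pi.smul_apply, smul_eq_mul]
    ring

/-- for every linear code `C ⊆ Rⁿ`, `|C| ⬝ |C^⊥| = q^{3n} = |R|ⁿ`. -/
theorem card_mul_card_dual (F : Type) [Field F] [Fintype F] (q : ℕ)
    (hq : Fintype.card F = q) (n : ℕ) (C : Submodule (Rv F) (Fin n → Rv F)) :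
    Nat.card C * Nat.card (dualSet (C : Set (Fin n → Rv F))) = q ^ (3 * n) ∧
      q ^ (3 * n) = Nat.card (Rv F) ^ n := by
  have hR : Module.finrank F (Rv F) = 3 := by
    rw [(AdjoinRoot.powerBasis' (monicV F)).finrank, AdjoinRoot.powerBasis'_dim,
      natDegree_X_pow_three_sub_X]
  have : Module.Finite F (Rv F) := (AdjoinRoot.powerBasis' (monicV F)).finite
  have hV : Module.finrank F (Fin n → Rv F) = 3 * n := by
    rw [Module.finrank_pi_fintype, Finset.sum_const, hR, Finset.card_univ, Fintype.card_fin,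
      smul_eq_mul, mul_comm]
  have hF : Nat.card F = q := Nat.card_eq_fintype_card.trans hq
  constructor
  · have hrank := LinearMap.BilinForm.finrank_orthogonal (topCoeffForm_nondegenerate F n)
      (C.restrictScalars F)
    have hle := (C.restrictScalars F).finrank_le
    rw [dualSet_eq_orthogonal]
    change Nat.card (C.restrictScalars F) *
      Nat.card ((topCoeffForm F n).orthogonal (C.restrictScalars F)) = _
    rw [Module.natCard_eq_pow_finrank (K := F), Module.natCard_eq_pow_finrank (K := F)
      (V := (topCoeffForm F n).orthogonal (C.restrictScalars F)), ← pow_add, hF, hrank,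
      Nat.add_sub_of_le hle, hV]
  · rw [Module.natCard_eq_pow_finrank (K := F) (V := Rv F), hR, hF, pow_mul]
end

section
/- Let A be a symmetric n × n matrix over R (Aᵀ = A) and let C = {(u, uA) : u ∈ R^n} ⊆ R^{2n} be the linear code of length 2n generated by [I_n | A]. Then C is formally self-dual: C and C^⊥ have the same Hamming weight distribution, i.e. for every integer w, the number of codewords of Hamming weight w in C equals the number of codewords of Hamming weight w in C^⊥. -/
open Polynomial

/-- The quarter turn `(a, b) ↦ (-b, a)` on words with two blocks. -/
def quarterTurn (R ι : Type) [CommRing R] : (ι ⊕ ι → R) ≃ (ι ⊕ ι → R) where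
  toFun x := Sum.elim (fun i => -x (Sum.inr i)) fun i => x (Sum.inl i)
  invFun x := Sum.elim (fun i => x (Sum.inr i)) fun i => -x (Sum.inl i)
  left_inv x := by ext (i | i) <;> simp
  right_inv x := by ext (i | i) <;> simp

lemma hWt_quarterTurn {R ι : Type} [CommRing R] [Fintype ι] (x : ι ⊕ ι → R) :
    hWt (quarterTurn R ι x) = hWt x := by
  refine Nat.card_congr ((Equiv.sumComm ι ι).subtypeEquiv ?_)
  rintro (i | i) <;> simp [quarterTurn]

lemma mem_range_graph_iff {R ι : Type} [CommRing R] [Fintype ι] (A : Matrix ι ι R)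
    (x : ι ⊕ ι → R) :
    (x ∈ Set.range fun u : ι → R => Sum.elim u (Matrix.vecMul u A)) ↔
      Matrix.vecMul (fun i => x (Sum.inl i)) A = fun i => x (Sum.inr i) := by
  constructor
  · rintro ⟨u, rfl⟩
    rfl
  · intro h
    exact ⟨fun i => x (Sum.inl i), by dsimp only; rw [h]; ext (i | i) <;> rfl⟩

lemma mem_dualSet_graph_iff {R ι : Type} [CommRing R] [Fintype ι] (A : Matrix ι ι R)
    (x : ι ⊕ ι → R) :
    (x ∈ dualSet (Set.range fun u : ι → R => Sum.elim u (Matrix.vecMul u A))) ↔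
      (fun i => x (Sum.inl i)) + Matrix.mulVec A (fun i => x (Sum.inr i)) = 0 := by
  rw [← dotProduct_eq_zero_iff]
  simp only [dualSet, Set.mem_ofPred_eq, Set.forall_mem_range, Fintype.sum_sum_type,
    Sum.elim_inl, Sum.elim_inr]
  refine forall_congr' fun u => ?_
  rw [add_dotProduct, dotProduct_comm (A.mulVec _), Matrix.dotProduct_mulVec,
    dotProduct_comm (Matrix.vecMul u A)]
  rfl

lemma quarterTurn_mem_dualSet_graph_iff {R ι : Type} [CommRing R] [Fintype ι]
    {A : Matrix ι ι R} (hA : A.transpose = A) (x : ι ⊕ ι → R) :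
    (x ∈ Set.range fun u : ι → R => Sum.elim u (Matrix.vecMul u A)) ↔
      quarterTurn R ι x ∈
        dualSet (Set.range fun u : ι → R => Sum.elim u (Matrix.vecMul u A)) := by
  rw [mem_range_graph_iff, mem_dualSet_graph_iff, ← Matrix.vecMul_transpose, hA]
  change _ ↔ -(fun i => x (Sum.inr i)) + Matrix.vecMul (fun i => x (Sum.inl i)) A = 0
  rw [neg_add_eq_zero, eq_comm]

/-- construction A: if `A` is a symmetric `n × n` matrix over `R`, then
the code `C = {(u, uA) : u ∈ Rⁿ}` generated by `[Iₙ | A]` is formally self-dual: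
`C` and `C^⊥` have the same Hamming weight distribution. -/
theorem constructionA_formally_self_dual (F : Type) [Field F] [Finite F] (n : ℕ)
    (A : Matrix (Fin n) (Fin n) (Rv F)) (hA : A.transpose = A) :
    ∀ w : ℕ,
      Nat.card {x : Fin n ⊕ Fin n → Rv F //
          x ∈ (Set.range fun u : Fin n → Rv F => Sum.elim u (Matrix.vecMul u A)) ∧
            hWt x = w} =
        Nat.card {x : Fin n ⊕ Fin n → Rv F //
          x ∈ dualSet (Set.range fun u : Fin n → Rv F => Sum.elim u (Matrix.vecMul u A)) ∧
            hWt x = w} := by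
  intro w
  refine Nat.card_congr ((quarterTurn (Rv F) (Fin n)).subtypeEquiv fun x => ?_)
  rw [hWt_quarterTurn, quarterTurn_mem_dualSet_graph_iff hA]
end

section
/- Let M be an n × n circulant matrix over R and let C = {(u, uM) : u ∈ R^n} ⊆ R^{2n} be the double circulant code of length 2n generated by [I_n | M]. Then C is formally self-dual: C and C^⊥ have the same Hamming weight distribution, i.e. for every integer w, the number of codewords of Hamming weight w in C equals the number of codewords of Hamming weight w in C^⊥. -/
open Polynomial

/-- The signed coordinate permutation `(x, y) ↦ (-y ∘ Neg.neg, x ∘ Neg.neg)`. -/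
def negSwap (A G : Type) [CommRing A] [AddCommGroup G] : (G ⊕ G → A) ≃ (G ⊕ G → A) where
  toFun x := Sum.elim (fun i => -x (Sum.inr (-i))) (fun i => x (Sum.inl (-i)))
  invFun x := Sum.elim (fun i => x (Sum.inr (-i))) (fun i => -x (Sum.inl (-i)))
  left_inv x := by ext (i | i) <;> simp
  right_inv x := by ext (i | i) <;> simp

lemma hWt_negSwap {A G : Type} [CommRing A] [AddCommGroup G] [Fintype G] (x : G ⊕ G → A) :
    hWt (negSwap A G x) = hWt x := by
  refine Nat.card_congr
    (((Equiv.sumComm G G).trans (Equiv.sumCongr (Equiv.neg G) (Equiv.neg G))).subtypeEquiv ?_)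
  rintro (i | i) <;> simp [negSwap]

lemma mem_dualSet_range_iff {A G : Type} [CommRing A] [Fintype G] (M : Matrix G G A)
    (x : G ⊕ G → A) :
    x ∈ dualSet (Set.range fun u : G → A => Sum.elim u (Matrix.vecMul u M)) ↔
      ∀ i, x (Sum.inl i) + ∑ j, M i j * x (Sum.inr j) = 0 := by
  classical
  have key (u : G → A) :
      ∑ i, x i * (Sum.elim u (Matrix.vecMul u M) : G ⊕ G → A) i =
        ∑ i, u i * (x (Sum.inl i) + ∑ j, M i j * x (Sum.inr j)) := by
    simp only [Fintype.sum_sum_type, Sum.elim_inl, Sum.elim_inr, Matrix.vecMul, dotProduct,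
      mul_add, Finset.sum_add_distrib, Finset.mul_sum]
    congr 1
    · exact Finset.sum_congr rfl fun i _ => mul_comm _ _
    · rw [Finset.sum_comm]
      exact Finset.sum_congr rfl fun i _ => Finset.sum_congr rfl fun j _ => by ring
  simp only [dualSet, Set.mem_ofPred_eq, Set.forall_mem_range, key]
  constructor
  · intro h i
    simpa [Pi.single_apply] using h (Pi.single i 1)
  · intro h u
    simp [h]

lemma negSwap_mem_dualSet_iff {A G : Type} [CommRing A] [AddCommGroup G] [Fintype G]
    {M : Matrix G G A} {m : G → A} (hM : ∀ i j, M i j = m (j - i)) (x : G ⊕ G → A) :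
    x ∈ (Set.range fun u : G → A => Sum.elim u (Matrix.vecMul u M)) ↔
      negSwap A G x ∈ dualSet (Set.range fun u : G → A => Sum.elim u (Matrix.vecMul u M)) := by
  have reflect (i : G) :
      ∑ j, M i j * x (Sum.inl (-j)) = Matrix.vecMul (fun j => x (Sum.inl j)) M (-i) := by
    rw [← Equiv.sum_comp (Equiv.neg G)]
    refine Finset.sum_congr rfl fun j _ => ?_
    simp only [Equiv.neg_apply, neg_neg, hM]
    rw [mul_comm, neg_sub_comm]
  rw [mem_dualSet_range_iff]
  simp only [negSwap, Equiv.coe_fn_mk, Sum.elim_inl, Sum.elim_inr, reflect]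
  constructor
  · rintro ⟨u, rfl⟩ i
    simp
  · intro h
    refine ⟨fun j => x (Sum.inl j), ?_⟩
    ext (i | i)
    · rfl
    · have hi := h (-i)
      rw [neg_neg, neg_add_eq_zero] at hi
      exact hi.symm

/-- A double circulant code over a commutative ring, with coordinates indexed by a finite
abelian group, has the same weight distribution as its dual. -/
lemma card_weight_eq_card_weight_dualSet {A G : Type} [CommRing A] [AddCommGroup G] [Fintype G]
    {M : Matrix G G A} {m : G → A} (hM : ∀ i j, M i j = m (j - i)) (w : ℕ) :
    Nat.card {x : G ⊕ G → A //
        x ∈ (Set.range fun u : G → A => Sum.elim u (Matrix.vecMul u M)) ∧ hWt x = w} =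
      Nat.card {x : G ⊕ G → A //
        x ∈ dualSet (Set.range fun u : G → A => Sum.elim u (Matrix.vecMul u M)) ∧
          hWt x = w} :=
  Nat.card_congr <| (negSwap A G).subtypeEquiv fun x => by
    rw [negSwap_mem_dualSet_iff hM, hWt_negSwap]

/-- construction B, double circulant: if `M` is an `n × n` circulant
matrix over `R`, then the code `C = {(u, uM) : u ∈ Rⁿ}` generated by `[Iₙ | M]` is
formally self-dual: `C` and `C^⊥` have the same Hamming weight distribution. -/
theorem constructionB_formally_self_dual (F : Type) [Field F] [Finite F] (n : ℕ)
    (M : Matrix (Fin n) (Fin n) (Rv F))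
    (hM : ∃ m : Fin n → Rv F, ∀ i j, M i j = m (j - i)) :
    ∀ w : ℕ,
      Nat.card {x : Fin n ⊕ Fin n → Rv F //
          x ∈ (Set.range fun u : Fin n → Rv F => Sum.elim u (Matrix.vecMul u M)) ∧
            hWt x = w} =
        Nat.card {x : Fin n ⊕ Fin n → Rv F //
          x ∈ dualSet (Set.range fun u : Fin n → Rv F => Sum.elim u (Matrix.vecMul u M)) ∧
            hWt x = w} := by
  obtain ⟨m, hm⟩ := hM
  intro w
  cases n with
  | zero =>
    refine Nat.card_congr (Equiv.subtypeEquivRight fun x => and_congr_left fun _ => ?_)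
    exact iff_of_true ⟨0, Subsingleton.elim _ _⟩ fun c _ => by simp
  | succ n => exact card_weight_eq_card_weight_dualSet hm w
end

section
/- Let n ≥ 2, let M be an (n−1) × (n−1) circulant matrix over R, let α, ω ∈ R, and let B be the n × n bordered matrix with B_{00} = α, B_{0j} = ω for 1 ≤ j ≤ n−1, B_{i0} = ω for 1 ≤ i ≤ n−1, and B_{ij} = M_{(i−1)(j−1)} for 1 ≤ i, j ≤ n−1. Let C = {(u, uB) : u ∈ R^n} ⊆ R^{2n} be the code of length 2n generated by [I_n | B]. Then C is formally self-dual: C and C^⊥ have the same Hamming weight distribution. -/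
open Polynomial

lemma mem_range_sumElim_vecMul {A ι : Type} [CommRing A] [Fintype ι] (B : Matrix ι ι A)
    (x : ι ⊕ ι → A) :
    x ∈ (Set.range fun u : ι → A => Sum.elim u (Matrix.vecMul u B)) ↔
      ∀ i, x (Sum.inr i) = Matrix.vecMul (x ∘ Sum.inl) B i := by
  constructor
  · rintro ⟨u, rfl⟩ i
    rfl
  · intro h
    refine ⟨x ∘ Sum.inl, ?_⟩
    ext (i | i)
    · rfl
    · exact (h i).symm

lemma mem_dualSet_range_sumElim_vecMul {A ι : Type} [CommRing A] [Fintype ι] (B : Matrix ι ι A)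
    (x : ι ⊕ ι → A) :
    x ∈ dualSet (Set.range fun u : ι → A => Sum.elim u (Matrix.vecMul u B)) ↔
      ∀ i, x (Sum.inl i) = -Matrix.mulVec B (x ∘ Sum.inr) i := by
  classical
  have key (u : ι → A) : ∑ i, x i * Sum.elim u (Matrix.vecMul u B) i =
      (x ∘ Sum.inl + Matrix.mulVec B (x ∘ Sum.inr)) ⬝ᵥ u := by
    rw [add_dotProduct, dotProduct_comm (Matrix.mulVec B _), Matrix.dotProduct_mulVec,
      dotProduct_comm (Matrix.vecMul u B), Fintype.sum_sum_type]
    rfl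
  simp only [dualSet, Set.mem_ofPred_eq, Set.forall_mem_range, key, dotProduct_eq_zero_iff,
    add_eq_zero_iff_eq_neg, funext_iff, Function.comp_apply, Pi.neg_apply]

/-- The signed coordinate permutation `(a, b) ↦ (-(b ∘ σ), a ∘ σ)`. -/
def negSwapEquiv {A ι : Type} [CommRing A] (σ : Equiv.Perm ι) : (ι ⊕ ι → A) ≃ (ι ⊕ ι → A) where
  toFun x := Sum.elim (fun i => -x (Sum.inr (σ i))) fun i => x (Sum.inl (σ i))
  invFun y := Sum.elim (fun i => y (Sum.inr (σ.symm i))) fun i => -y (Sum.inl (σ.symm i))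
  left_inv x := by ext (i | i) <;> simp
  right_inv y := by ext (i | i) <;> simp

lemma hWt_negSwapEquiv {A ι : Type} [CommRing A] [Fintype ι] (σ : Equiv.Perm ι)
    (x : ι ⊕ ι → A) : hWt (negSwapEquiv σ x) = hWt x := by
  refine Nat.card_congr (((Equiv.sumComm ι ι).trans (Equiv.sumCongr σ σ)).subtypeEquiv ?_)
  rintro (i | i) <;> simp [negSwapEquiv]

lemma negSwapEquiv_mem_dualSet {A ι : Type} [CommRing A] [Fintype ι] (B : Matrix ι ι A)
    (σ : Equiv.Perm ι) (hσ : ∀ i j, B (σ i) (σ j) = B j i) (x : ι ⊕ ι → A) :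
    negSwapEquiv σ x ∈
        dualSet (Set.range fun u : ι → A => Sum.elim u (Matrix.vecMul u B)) ↔
      x ∈ (Set.range fun u : ι → A => Sum.elim u (Matrix.vecMul u B)) := by
  rw [mem_dualSet_range_sumElim_vecMul, mem_range_sumElim_vecMul,
    ← σ.forall_congr_right (q := fun i => x (Sum.inr i) = _)]
  refine forall_congr' fun i => ?_
  have h : Matrix.mulVec B (negSwapEquiv σ x ∘ Sum.inr) i =
      Matrix.vecMul (x ∘ Sum.inl) B (σ i) := by
    simp only [Matrix.mulVec, Matrix.vecMul, dotProduct]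
    rw [← Equiv.sum_comp σ fun j => (x ∘ Sum.inl) j * B j (σ i)]
    exact Finset.sum_congr rfl fun j _ => by simp [negSwapEquiv, hσ, mul_comm]
  rw [h]
  exact neg_inj

/-- A matrix that is conjugate to its transpose by a permutation matrix generates, together with
the identity, a formally self-dual code. -/
lemma card_range_eq_card_dualSet {A ι : Type} [CommRing A] [Fintype ι] (B : Matrix ι ι A)
    (σ : Equiv.Perm ι) (hσ : ∀ i j, B (σ i) (σ j) = B j i) (w : ℕ) :
    Nat.card {x : ι ⊕ ι → A //
        x ∈ (Set.range fun u : ι → A => Sum.elim u (Matrix.vecMul u B)) ∧ hWt x = w} =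
      Nat.card {x : ι ⊕ ι → A //
        x ∈ dualSet (Set.range fun u : ι → A => Sum.elim u (Matrix.vecMul u B)) ∧
          hWt x = w} :=
  Nat.card_congr <| (negSwapEquiv σ).subtypeEquiv fun x => by
    rw [negSwapEquiv_mem_dualSet B σ hσ, hWt_negSwapEquiv]

/-- The permutation of `Fin (k + 1)` fixing `0` and acting as negation modulo `k` on the rest. -/
def borderedNeg (k : ℕ) [NeZero k] : Equiv.Perm (Fin (k + 1)) :=
  Function.Involutive.toPerm (Fin.cons 0 fun i : Fin k => (-i).succ) fun i => by
    cases i using Fin.cases <;> simp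

@[simp]
lemma borderedNeg_zero (k : ℕ) [NeZero k] : borderedNeg k 0 = 0 := rfl

@[simp]
lemma borderedNeg_succ (k : ℕ) [NeZero k] (i : Fin k) : borderedNeg k i.succ = (-i).succ := rfl

/-- construction C: let `n = k + 1 ≥ 2`, let `M` be a `(n-1) × (n-1)`
circulant matrix over `R`, let `α, ω ∈ R` and let `B` be the `n × n` bordered matrix
with `B₀₀ = α`, `B₀ⱼ = ω`, `Bᵢ₀ = ω` and `Bᵢⱼ = M_{(i-1)(j-1)}` otherwise. Then the code
`C = {(u, uB) : u ∈ Rⁿ}` generated by `[Iₙ | B]` is formally self-dual. -/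
theorem constructionC_formally_self_dual (F : Type) [Field F] [Finite F]
    (k : ℕ) (hk : 1 ≤ k) (M : Matrix (Fin k) (Fin k) (Rv F))
    (hM : ∃ m : Fin k → Rv F, ∀ i j, M i j = m (j - i)) (α ω : Rv F)
    (B : Matrix (Fin (k + 1)) (Fin (k + 1)) (Rv F))
    (hB : B = Matrix.of (Fin.cons (Fin.cons α fun _ => ω) fun i => Fin.cons ω (M i))) :
    ∀ w : ℕ,
      Nat.card {x : Fin (k + 1) ⊕ Fin (k + 1) → Rv F //
          x ∈ (Set.range fun u : Fin (k + 1) → Rv F => Sum.elim u (Matrix.vecMul u B)) ∧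
            hWt x = w} =
        Nat.card {x : Fin (k + 1) ⊕ Fin (k + 1) → Rv F //
          x ∈ dualSet
              (Set.range fun u : Fin (k + 1) → Rv F => Sum.elim u (Matrix.vecMul u B)) ∧
            hWt x = w} := by
  have : NeZero k := ⟨by omega⟩
  obtain ⟨m, hm⟩ := hM
  refine card_range_eq_card_dualSet B (borderedNeg k) fun i j => ?_
  subst hB
  cases i using Fin.cases <;> cases j using Fin.cases <;> simp [hm, neg_add_eq_sub]
end
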